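/- Consider a scaling (K_{1,n}, …, K_{r,n}, P_n, α_n) such that Λ_1(n) = c_n · (log n)/n for every n, where c_n → c and c > 1. Then the probability that the random graph G(n; μ, K_n, P_n, α_n) has no isolated vertices tends to 1 as n → ∞. -/

import Mathlib

open Filter Real

noncomputable section

namespace HetKey

/-- The set of ordered index pairs `x < y` (one Bernoulli coin per unordered pair). -/
abbrev Pairs (n : ℕ) : Type := {p : Fin n × Fin n // p.1 < p.2}

/-- A configuration of the randomness: the class of each vertex, the key ring of each
vertex (a subset of the key pool `{1,…,P}`), and the Bernoulli link coins. -/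
abbrev Config (n r P : ℕ) : Type :=
  (Fin n → Fin r) × (Fin n → Finset (Fin P)) × (Pairs n → Bool)

/-- Weight of a key ring under the uniform distribution on `k`-subsets of the pool. -/
def keyWeight (P k : ℕ) (s : Finset (Fin P)) : ℝ :=
  if s.card = k then ((P.choose k : ℝ))⁻¹ else 0

/-- Probability weight of a configuration: classes are i.i.d. with law `μ`, key rings are
(conditionally) uniform `K (class)`-subsets, link coins are i.i.d. Bernoulli(`α`). -/
def weight {n r P : ℕ} (μ : Fin r → ℝ) (K : Fin r → ℕ) (α : ℝ)
    (cfg : Config n r P) : ℝ :=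
  (∏ x, μ (cfg.1 x) * keyWeight P (K (cfg.1 x)) (cfg.2.1 x)) *
    ∏ p, (if cfg.2.2 p then α else 1 - α)

open scoped Classical in
/-- Probability of an event in `G(n; μ, K, P, α)`. -/
def Pr {n r P : ℕ} (μ : Fin r → ℝ) (K : Fin r → ℕ) (α : ℝ)
    (E : Config n r P → Prop) : ℝ :=
  ∑ cfg, if E cfg then weight μ K α cfg else 0

/-- Expectation of a random variable on the configuration space. -/
def expect {n r P : ℕ} (μ : Fin r → ℝ) (K : Fin r → ℕ) (α : ℝ)
    (X : Config n r P → ℝ) : ℝ :=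
  ∑ cfg, weight μ K α cfg * X cfg

/-- The Bernoulli coin attached to the unordered pair `{x, y}`. -/
def coin {n : ℕ} (b : Pairs n → Bool) (x y : Fin n) : Bool :=
  if h : x < y then b ⟨(x, y), h⟩
  else if h' : y < x then b ⟨(y, x), h'⟩
  else false

/-- Adjacency in `G(n; μ, K, P, α)`: distinct vertices, intersecting key rings, and an
operational (non-failed) link. -/
def adj {n r P : ℕ} (cfg : Config n r P) (x y : Fin n) : Prop :=
  x ≠ y ∧ (cfg.2.1 x ∩ cfg.2.1 y).Nonempty ∧ coin cfg.2.2 x y = true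

/-- A vertex is isolated if it has no neighbours. -/
def isolated {n r P : ℕ} (cfg : Config n r P) (x : Fin n) : Prop :=
  ∀ y, ¬ adj cfg x y

/-- Connectivity: every pair of vertices is joined by a path. -/
def conn {n r P : ℕ} (cfg : Config n r P) : Prop :=
  ∀ x y : Fin n, Relation.ReflTransGen (adj cfg) x y

/-- `p_{ij}`: the probability that a uniform `K_i`-subset and an independent uniform
`K_j`-subset of a pool of size `P` intersect. -/
def pEdge (P Ki Kj : ℕ) : ℝ :=
  1 - ((P - Ki).choose Kj : ℝ) / (P.choose Kj : ℝ)

/-- `λ_i = Σ_j μ_j p_{ij}`. -/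
def lam {r : ℕ} (μ : Fin r → ℝ) (K : Fin r → ℕ) (P : ℕ) (i : Fin r) : ℝ :=
  ∑ j, μ j * pEdge P (K i) (K j)

/-- `Λ_i = α λ_i`. -/
def Lam {r : ℕ} (μ : Fin r → ℝ) (K : Fin r → ℕ) (P : ℕ) (α : ℝ) (i : Fin r) : ℝ :=
  α * lam μ K P i

end HetKey

open HetKey

namespace HetKey

theorem sum_pi_prod_eq {ι A : Type*} [Fintype ι] [DecidableEq ι] [Fintype A]
    (g : ι → A → ℝ) : ∑ f : ι → A, ∏ y, g y (f y) = ∏ y, ∑ a, g y a := by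
  rw [Finset.prod_univ_sum, Fintype.piFinset_univ]

open Finset in
/-- Conditioning a product weight on the coordinate `x`. -/
theorem sum_pi_prod_mul_prod_erase {ι A : Type*} [Fintype ι] [DecidableEq ι] [Fintype A]
    [DecidableEq A] (w : A → ℝ) (h : A → A → ℝ) (x : ι) :
    ∑ f : ι → A, (∏ y, w (f y)) * ∏ y ∈ univ.erase x, h (f x) (f y) =
      ∑ a, w a * (∑ b, w b * h a b) ^ (Fintype.card ι - 1) := by
  have key : ∀ a : A, w a * (∑ b, w b * h a b) ^ (Fintype.card ι - 1) =
      ∑ f : ι → A, if f x = a then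
        (∏ y, w (f y)) * ∏ y ∈ univ.erase x, h (f x) (f y) else 0 := by
    intro a
    have h1 := sum_pi_prod_eq (ι := ι) (A := A)
      (fun y b => if y = x then (if b = a then w a else 0) else w b * h a b)
    rw [← Finset.mul_prod_erase univ _ (mem_univ x)] at h1
    rw [Finset.prod_congr (g := fun _ => ∑ b, w b * h a b) rfl
      (fun y hy => by simp [(Finset.mem_erase.1 hy).1])] at h1
    rw [Finset.prod_const, Finset.card_erase_of_mem (mem_univ x), Finset.card_univ] at h1
    simp only [if_true, Finset.sum_ite_eq', mem_univ] at h1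
    rw [← h1]
    refine Finset.sum_congr rfl fun f _ => ?_
    rw [← Finset.mul_prod_erase univ _ (mem_univ x)]
    rw [Finset.prod_congr (g := fun y => w (f y) * h a (f y)) rfl
      (fun y hy => by simp [(Finset.mem_erase.1 hy).1])]
    rw [Finset.prod_mul_distrib, ← Finset.mul_prod_erase univ (fun y => w (f y)) (mem_univ x)]
    by_cases hf : f x = a
    · simp [hf, mul_assoc]
    · simp [hf]
  simp_rw [key]
  rw [Finset.sum_comm]
  simp

theorem keyWeight_nonneg (P k : ℕ) (s : Finset (Fin P)) : 0 ≤ keyWeight P k s := by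
  unfold keyWeight
  split_ifs <;> positivity

theorem sum_keyWeight_disjoint {P k : ℕ} (S : Finset (Fin P)) :
    ∑ T, (if (S ∩ T).Nonempty then 0 else keyWeight P k T) =
      ((P - S.card).choose k : ℝ) / (P.choose k : ℝ) := by
  have h : ∀ T : Finset (Fin P), (if (S ∩ T).Nonempty then 0 else keyWeight P k T) =
      if T ∈ Finset.powersetCard k Sᶜ then ((P.choose k : ℝ))⁻¹ else 0 := by
    intro T
    have hd : T ⊆ Sᶜ ↔ ¬ (S ∩ T).Nonempty := by
      rw [Finset.subset_compl_iff_disjoint_left, Finset.not_nonempty_iff_eq_empty,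
        Finset.disjoint_iff_inter_eq_empty]
    simp only [Finset.mem_powersetCard, hd]
    unfold keyWeight
    by_cases h1 : (S ∩ T).Nonempty <;> simp [h1]
  simp_rw [h]
  rw [Finset.sum_ite_mem, Finset.univ_inter, Finset.sum_const, Finset.card_powersetCard,
    Finset.card_compl, Fintype.card_fin, nsmul_eq_mul, div_eq_mul_inv]

theorem sum_keyWeight {P k : ℕ} (hk : k ≤ P) : ∑ T, keyWeight P k T = 1 := by
  have h := sum_keyWeight_disjoint (k := k) (∅ : Finset (Fin P))
  have h0 : (P.choose k : ℝ) ≠ 0 := by exact_mod_cast (Nat.choose_pos hk).ne'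
  simpa [h0] using h

theorem sum_keyWeight_mul {P k : ℕ} (hk : k ≤ P) (S : Finset (Fin P)) (α : ℝ) :
    ∑ T, keyWeight P k T * (if (S ∩ T).Nonempty then 1 - α else 1) =
      1 - α * pEdge P S.card k := by
  have h : ∀ T, keyWeight P k T * (if (S ∩ T).Nonempty then 1 - α else 1) =
      (1 - α) * keyWeight P k T + α * (if (S ∩ T).Nonempty then 0 else keyWeight P k T) := by
    intro T
    split_ifs <;> ring
  simp_rw [h]
  rw [Finset.sum_add_distrib, ← Finset.mul_sum, ← Finset.mul_sum, sum_keyWeight hk,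
    sum_keyWeight_disjoint, pEdge]
  ring

theorem pEdge_mem_Icc (P Ki Kj : ℕ) : pEdge P Ki Kj ∈ Set.Icc (0 : ℝ) 1 := by
  have h1 : ((P - Ki).choose Kj : ℝ) ≤ (P.choose Kj : ℝ) := by
    exact_mod_cast Nat.choose_le_choose Kj (Nat.sub_le P Ki)
  have h2 : ((P - Ki).choose Kj : ℝ) / (P.choose Kj : ℝ) ≤ 1 := div_le_one_of_le₀ h1 (by positivity)
  have h3 : 0 ≤ ((P - Ki).choose Kj : ℝ) / (P.choose Kj : ℝ) := by positivity
  unfold pEdge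
  constructor <;> linarith

theorem pEdge_mono {P Ki Ki' : ℕ} (Kj : ℕ) (h : Ki ≤ Ki') : pEdge P Ki Kj ≤ pEdge P Ki' Kj := by
  have h1 : ((P - Ki').choose Kj : ℝ) ≤ ((P - Ki).choose Kj : ℝ) := by
    exact_mod_cast Nat.choose_le_choose Kj (Nat.sub_le_sub_left h P)
  unfold pEdge
  gcongr

section Model

variable {n r P : ℕ} {μ : Fin r → ℝ} {K : Fin r → ℕ} {α : ℝ}

theorem lam_le_one (hμ : ∀ i, 0 ≤ μ i) (hsum : ∑ i, μ i = 1) (i : Fin r) : lam μ K P i ≤ 1 := by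
  rw [← hsum]
  exact Finset.sum_le_sum fun j _ => mul_le_of_le_one_right (hμ j) (pEdge_mem_Icc _ _ _).2

theorem Lam_le_one (hμ : ∀ i, 0 ≤ μ i) (hsum : ∑ i, μ i = 1) (h0 : 0 ≤ α) (h1 : α ≤ 1)
    (i : Fin r) : Lam μ K P α i ≤ 1 :=
  (mul_le_of_le_one_right h0 (lam_le_one hμ hsum i)).trans h1

theorem Lam_mono (hμ : ∀ i, 0 ≤ μ i) (h0 : 0 ≤ α) (hK : Monotone K) :
    Monotone (Lam μ K P α) := fun _ _ hij =>
  mul_le_mul_of_nonneg_left (Finset.sum_le_sum fun j _ =>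
    mul_le_mul_of_nonneg_left (pEdge_mono _ (hK hij)) (hμ j)) h0

theorem weight_nonneg (hμ : ∀ i, 0 ≤ μ i) (h0 : 0 ≤ α) (h1 : α ≤ 1) (cfg : Config n r P) :
    0 ≤ weight μ K α cfg := by
  refine mul_nonneg (Finset.prod_nonneg fun x _ => mul_nonneg (hμ _) (keyWeight_nonneg _ _ _))
    (Finset.prod_nonneg fun p _ => ?_)
  split_ifs <;> linarith

theorem sum_weight (hsum : ∑ i, μ i = 1) (hK : ∀ i, K i ≤ P) :
    ∑ cfg : Config n r P, weight μ K α cfg = 1 := by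
  have hcoin : ∑ b : Pairs n → Bool, ∏ p, (if b p then α else 1 - α) = 1 :=
    (sum_pi_prod_eq (fun (_ : Pairs n) (b : Bool) => if b then α else 1 - α)).trans (by simp)
  simp_rw [Fintype.sum_prod_type, weight, ← Finset.mul_sum, hcoin]
  have h (t : Fin n → Fin r) := sum_pi_prod_eq (ι := Fin n) (A := Finset (Fin P))
    (fun x s => μ (t x) * keyWeight P (K (t x)) s)
  simp_rw [← Finset.sum_mul, h, ← Finset.mul_sum, sum_keyWeight (hK _)]
  rw [sum_pi_prod_eq (fun _ i => μ i * 1)]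
  simp [hsum]

open Finset in
/-- A product over the pairs containing `x` is a product over the other vertices. -/
theorem prod_pairs_incident (x : Fin n) (φ : Fin n → Fin n → ℝ) (hφ : ∀ a b, φ a b = φ b a) :
    ∏ p : Pairs n, (if p.1.1 = x ∨ p.1.2 = x then φ p.1.1 p.1.2 else 1) =
      ∏ y ∈ univ.erase x, φ x y := by
  rw [← Finset.prod_filter]
  refine Finset.prod_bij (fun p _ => if p.1.1 = x then p.1.2 else p.1.1) ?_ ?_ ?_ ?_
  · rintro ⟨⟨a, b⟩, hab⟩ hp
    simp only [mem_filter, mem_univ, true_and, mem_erase, and_true] at hp ⊢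
    split_ifs with h
    · rintro rfl
      exact absurd hab (by simp [h])
    · exact h
  · rintro ⟨⟨a, b⟩, hab⟩ hp ⟨⟨a', b'⟩, hab'⟩ hp' heq
    simp only [mem_filter, mem_univ, true_and, Subtype.mk.injEq, Prod.mk.injEq] at hp hp' heq ⊢
    simp only at hab hab'
    split_ifs at heq <;> constructor <;> omega
  · intro y hy
    have hne : y ≠ x := (Finset.mem_erase.1 hy).1
    rcases lt_or_gt_of_ne hne with h | h
    · exact ⟨⟨(y, x), h⟩, by simp, by simp [hne]⟩
    · exact ⟨⟨(x, y), h⟩, by simp, by simp⟩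
  · rintro ⟨⟨a, b⟩, hab⟩ hp
    simp only [mem_filter, mem_univ, true_and] at hp ⊢
    split_ifs with h
    · rw [h]
    · rw [hφ, hp.resolve_left h]

theorem isolated_iff (cfg : Config n r P) (x : Fin n) :
    isolated cfg x ↔ ∀ p : Pairs n, (p.1.1 = x ∨ p.1.2 = x) →
      (cfg.2.1 p.1.1 ∩ cfg.2.1 p.1.2).Nonempty → cfg.2.2 p = false := by
  constructor
  · rintro h ⟨⟨a, b⟩, hab⟩ hx hne
    have hab' : a < b := hab
    simp only at hx hne
    rcases hx with rfl | rfl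
    · have := h b
      simpa [adj, hne, hab'.ne, coin, hab'] using this
    · have := h a
      rw [Finset.inter_comm] at hne
      simpa [adj, hne, hab'.ne', coin, hab', hab'.not_gt] using this
  · rintro h y ⟨hxy, hne, hc⟩
    rcases lt_or_gt_of_ne hxy with hlt | hlt
    · have := h ⟨(x, y), hlt⟩ (Or.inl rfl) hne
      simp [coin, hlt, this] at hc
    · have := h ⟨(y, x), hlt⟩ (Or.inr rfl) (by rwa [Finset.inter_comm] at hne)
      simp [coin, hlt, hlt.not_gt, this] at hc

open Finset in
open scoped Classical in
/-- Given the classes and key rings, the links at `x` are independent. -/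
theorem sum_coins_isolated (t : Fin n → Fin r) (s : Fin n → Finset (Fin P)) (x : Fin n) :
    ∑ b : Pairs n → Bool, (if isolated (t, s, b) x then
        ∏ p, (if b p then α else 1 - α) else 0) =
      ∏ y ∈ univ.erase x, (if (s x ∩ s y).Nonempty then 1 - α else 1) := by
  rw [← prod_pairs_incident x (fun a b => if (s a ∩ s b).Nonempty then 1 - α else 1)
    (fun a b => by rw [Finset.inter_comm])]
  have h := sum_pi_prod_eq (ι := Pairs n) (A := Bool) (fun p c =>
    if (p.1.1 = x ∨ p.1.2 = x) → (s p.1.1 ∩ s p.1.2).Nonempty → c = false then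
      (if c then α else 1 - α) else 0)
  trans
  · refine (Finset.sum_congr rfl fun b _ => ?_).trans h
    simp only [isolated_iff]
    rw [Finset.prod_ite_zero]
    simp
  · refine Finset.prod_congr rfl fun p _ => ?_
    by_cases h1 : p.1.1 = x ∨ p.1.2 = x <;> by_cases h2 : (s p.1.1 ∩ s p.1.2).Nonempty <;>
      simp [h1, h2]

/-- The exact probability that a given vertex is isolated. -/
theorem Pr_isolated (hsum : ∑ i, μ i = 1) (hK : ∀ i, K i ≤ P) (x : Fin n) :
    Pr (n := n) (P := P) μ K α (fun cfg => isolated cfg x) =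
      ∑ i, μ i * (1 - Lam μ K P α i) ^ (n - 1) := by
  classical
  let w : Fin r × Finset (Fin P) → ℝ := fun a => μ a.1 * keyWeight P (K a.1) a.2
  let h : Fin r × Finset (Fin P) → Fin r × Finset (Fin P) → ℝ :=
    fun a b => if (a.2 ∩ b.2).Nonempty then 1 - α else 1
  have hw : ∀ a : Fin r × Finset (Fin P), a.2.card = K a.1 →
      ∑ b, w b * h a b = 1 - Lam μ K P α a.1 := by
    intro a ha
    simp only [w, h, Fintype.sum_prod_type, mul_assoc, ← Finset.mul_sum, sum_keyWeight_mul (hK _),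
      ha, mul_sub, Finset.sum_sub_distrib, mul_one, hsum, Lam, lam]
    rw [Finset.mul_sum]
    congr 1
    exact Finset.sum_congr rfl fun _ _ => by ring
  have hmain := sum_pi_prod_mul_prod_erase w h x
  rw [Fintype.card_fin, Fintype.sum_prod_type] at hmain
  have hrhs : ∀ i, ∑ S, w (i, S) * (∑ b, w b * h (i, S) b) ^ (n - 1) =
      μ i * (1 - Lam μ K P α i) ^ (n - 1) := by
    intro i
    have : ∀ S, w (i, S) * (∑ b, w b * h (i, S) b) ^ (n - 1) =
        keyWeight P (K i) S * (μ i * (1 - Lam μ K P α i) ^ (n - 1)) := by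
      intro S
      by_cases hS : S.card = K i
      · rw [hw (i, S) hS]
        simp only [w]
        ring
      · simp [w, keyWeight, hS]
    simp_rw [this]
    rw [← Finset.sum_mul, sum_keyWeight (hK i), one_mul]
  simp_rw [hrhs] at hmain
  rw [← hmain, ← (Equiv.arrowProdEquivProdArrow (Fin n) (fun _ => Fin r)
    (fun _ => Finset (Fin P))).symm.sum_comp, Fintype.sum_prod_type, Pr, Fintype.sum_prod_type]
  refine Finset.sum_congr rfl fun t _ => ?_
  rw [Fintype.sum_prod_type]
  refine Finset.sum_congr rfl fun s _ => ?_
  simp only [w, h, Equiv.arrowProdEquivProdArrow_symm_apply]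
  rw [← sum_coins_isolated (α := α) t s x, Finset.mul_sum]
  refine Finset.sum_congr rfl fun b _ => ?_
  rw [mul_ite, mul_zero]
  rfl

theorem Pr_le_one (hμ : ∀ i, 0 ≤ μ i) (hsum : ∑ i, μ i = 1) (h0 : 0 ≤ α) (h1 : α ≤ 1)
    (hK : ∀ i, K i ≤ P) (E : Config n r P → Prop) : Pr μ K α E ≤ 1 := by
  rw [← sum_weight (n := n) (α := α) hsum hK, Pr]
  refine Finset.sum_le_sum fun cfg _ => ?_
  have := weight_nonneg (K := K) hμ h0 h1 cfg
  split_ifs <;> simp [this]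

theorem one_sub_sum_le_Pr (hμ : ∀ i, 0 ≤ μ i) (hsum : ∑ i, μ i = 1) (h0 : 0 ≤ α) (h1 : α ≤ 1)
    (hK : ∀ i, K i ≤ P) (E : Fin n → Config n r P → Prop) :
    1 - ∑ x, Pr μ K α (E x) ≤ Pr μ K α (fun cfg => ∀ x, ¬ E x cfg) := by
  classical
  rw [sub_le_iff_le_add, ← sum_weight (n := n) (α := α) hsum hK]
  simp only [Pr]
  rw [Finset.sum_comm, ← Finset.sum_add_distrib]
  refine Finset.sum_le_sum fun cfg _ => ?_
  have hw := weight_nonneg (K := K) hμ h0 h1 cfg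
  have hnn : ∀ x ∈ Finset.univ, 0 ≤ (if E x cfg then weight μ K α cfg else 0) := by
    intro x _
    split_ifs <;> simp [hw]
  by_cases h : ∀ x, ¬ E x cfg
  · simp [h]
  · rw [if_neg h, zero_add]
    push Not at h
    obtain ⟨x, hx⟩ := h
    simpa [hx] using Finset.single_le_sum hnn (Finset.mem_univ x)

theorem Pr_isolated_le (hμ : ∀ i, 0 ≤ μ i) (hsum : ∑ i, μ i = 1) (h0 : 0 ≤ α) (h1 : α ≤ 1)
    (hK : ∀ i, K i ≤ P) (hmono : Monotone K) {i₀ : Fin r} (hi₀ : ∀ i, i₀ ≤ i) (x : Fin n) :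
    Pr (n := n) (P := P) μ K α (fun cfg => isolated cfg x) ≤
      exp (-Lam μ K P α i₀ * (n - 1)) := by
  have hn : ((n - 1 : ℕ) : ℝ) = (n : ℝ) - 1 := by
    rw [Nat.cast_sub (by have := x.2; omega), Nat.cast_one]
  rw [Pr_isolated hsum hK x, ← hn, mul_comm (-Lam μ K P α i₀), Real.exp_nat_mul,
    ← one_mul (exp _ ^ _), ← hsum, Finset.sum_mul]
  refine Finset.sum_le_sum fun i _ => mul_le_mul_of_nonneg_left ?_ (hμ i)
  refine pow_le_pow_left₀ (by linarith [Lam_le_one (K := K) (P := P) hμ hsum h0 h1 i]) ?_ _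
  have := Lam_mono (P := P) hμ h0 hmono (hi₀ i)
  linarith [Real.add_one_le_exp (-Lam μ K P α i₀)]

end Model

theorem tendsto_mul_exp_log_div {cn : ℕ → ℝ} {c : ℝ} (hcn : Tendsto cn atTop (nhds c))
    (hc : 1 < c) :
    Tendsto (fun n : ℕ => (n : ℝ) * exp (-(cn n * Real.log n / n) * (n - 1))) atTop (nhds 0) := by
  have hinv : Tendsto (fun n : ℕ => 1 - (n : ℝ)⁻¹) atTop (nhds 1) := by
    simpa using tendsto_const_nhds.sub (tendsto_inv_atTop_nhds_zero_nat (𝕜 := ℝ))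
  have h1 : Tendsto (fun n : ℕ => cn n * (1 - (n : ℝ)⁻¹) - 1) atTop (nhds (c - 1)) := by
    simpa using (hcn.mul hinv).sub_const 1
  have hlog : Tendsto (fun n : ℕ => Real.log n) atTop atTop :=
    Real.tendsto_log_atTop.comp tendsto_natCast_atTop_atTop
  have h2 := Real.tendsto_exp_neg_atTop_nhds_zero.comp
    (h1.pos_mul_atTop (by linarith) hlog)
  refine h2.congr' ?_
  filter_upwards [eventually_ge_atTop 1] with n hn
  have hn' : (0 : ℝ) < n := by exact_mod_cast hn
  calc _ = exp (log n + -(cn n * log n / n) * (n - 1)) := by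
        rw [Function.comp_apply]
        congr 1
        field_simp
        ring
    _ = _ := by rw [Real.exp_add, Real.exp_log hn']

end HetKey

/-- one-law for absence of isolated nodes: if
`Λ_1(n) = c_n log n / n` with `c_n → c` and `c > 1`, then the probability
that `G(n; μ, K_n, P_n, α_n)` has no isolated vertices tends to `1`. -/
theorem isolated_nodes_one_law
    (r : ℕ) (hr : 0 < r)
    (μ : Fin r → ℝ) (hμpos : ∀ i, 0 < μ i) (hμsum : ∑ i, μ i = 1)
    (K : ℕ → Fin r → ℕ) (Pn : ℕ → ℕ) (α : ℕ → ℝ)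
    (hα0 : ∀ n, 0 < α n) (hα1 : ∀ n, α n < 1)
    (hK1 : ∀ n i, 1 ≤ K n i)
    (hKmono : ∀ n, Monotone (K n))
    (hKP : ∀ n i, 2 * K n i ≤ Pn n)
    (cn : ℕ → ℝ) (c : ℝ)
    (hcn : Tendsto cn atTop (nhds c)) (hc : 1 < c)
    (hΛ : ∀ n, 2 ≤ n →
      Lam μ (K n) (Pn n) (α n) ⟨0, hr⟩ = cn n * Real.log n / n) :
    Tendsto
      (fun n => Pr (n := n) (P := Pn n) μ (K n) (α n)
        (fun cfg => ∀ x, ¬ isolated cfg x))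
      atTop (nhds 1) := by
  have hK : ∀ n i, K n i ≤ Pn n := fun n i => by have := hKP n i; omega
  have hμ : ∀ i, 0 ≤ μ i := fun i => (hμpos i).le
  have hlim : Tendsto (fun n : ℕ => 1 - (n : ℝ) * exp (-(cn n * Real.log n / n) * (n - 1)))
      atTop (nhds 1) := by
    simpa using tendsto_const_nhds.sub (tendsto_mul_exp_log_div hcn hc)
  refine tendsto_of_tendsto_of_tendsto_of_le_of_le' hlim tendsto_const_nhds ?_
    (Eventually.of_forall fun n => Pr_le_one hμ hμsum (hα0 n).le (hα1 n).le (hK n) _)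
  filter_upwards [eventually_ge_atTop 2] with n hn
  refine le_trans ?_ (one_sub_sum_le_Pr hμ hμsum (hα0 n).le (hα1 n).le (hK n)
    (fun x cfg => isolated cfg x))
  have hsum : ∑ x : Fin n, Pr (n := n) (P := Pn n) μ (K n) (α n) (fun cfg => isolated cfg x) ≤
      ∑ _x : Fin n, exp (-(cn n * Real.log n / n) * (n - 1)) := by
    refine Finset.sum_le_sum fun x _ => ?_
    rw [← hΛ n hn]
    exact Pr_isolated_le hμ hμsum (hα0 n).le (hα1 n).le (hK n) (hKmono n)
      (fun i => Fin.mk_le_of_le_val (Nat.zero_le _)) x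
  rw [Finset.sum_const, Finset.card_univ, Fintype.card_fin, nsmul_eq_mul] at hsum
  linarith
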